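/- Let v : ℝ → ℝ be twice continuously differentiable with v''(x) + f(v(x)) = 0 and 0 < v(x) < 1 for all x ≥ 0, and suppose v(x) → 0 as x → ∞. Then there exists b ∈ ℝ such that v(x) = V(x + b) for all x ≥ 0, where V is the pulse solution. -/

import Mathlib

open Set Filter Topology

/-- The primitive `F(s) = ∫₀^s f(r) dr`. -/
noncomputable def F (f : ℝ → ℝ) (s : ℝ) : ℝ := ∫ r in (0:ℝ)..s, f r

/-- Bistable nonlinearity with balanced-positive integral. -/
def Bistable (f : ℝ → ℝ) (a : ℝ) : Prop :=
  ContDiff ℝ 1 f ∧ 0 < a ∧ a < 1 ∧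
  f 0 = 0 ∧ f a = 0 ∧ f 1 = 0 ∧
  (∀ s, 0 < s → s < a → f s < 0) ∧
  (∀ s, a < s → s < 1 → 0 < f s) ∧
  deriv f 0 < 0 ∧ 0 < deriv f a ∧ deriv f 1 < 0 ∧
  0 < ∫ s in (0:ℝ)..(1:ℝ), f s


theorem hasDerivAt_F {f : ℝ → ℝ} (hf : Continuous f) (s : ℝ) : HasDerivAt (F f) (f s) s :=
  intervalIntegral.integral_hasDerivAt_right (hf.intervalIntegrable _ _)
    (hf.stronglyMeasurableAtFilter _ _) hf.continuousAt

theorem hasDerivAt_deriv_of_contDiff_two {u : ℝ → ℝ} (hu : ContDiff ℝ 2 u) (x : ℝ) :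
    HasDerivAt (deriv u) (deriv (deriv u) x) x := by
  have h : ContDiff ℝ 1 (deriv u) := ((contDiff_succ_iff_deriv (n := 1)).1 hu).2.2
  exact (h.differentiable (by norm_num) x).hasDerivAt

/-- A differentiable function with a limit at infinity has arbitrarily far points at which the
derivative is small. -/
theorem exists_tendsto_atTop_deriv_tendsto_zero {u : ℝ → ℝ} (hu : Differentiable ℝ u) {l : ℝ}
    (hlim : Tendsto u atTop (𝓝 l)) :
    ∃ ξ : ℕ → ℝ, (∀ n, 0 ≤ ξ n) ∧ Tendsto ξ atTop atTop ∧
      Tendsto (fun n => deriv u (ξ n)) atTop (𝓝 0) := by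
  have h (n : ℕ) : ∃ c ∈ Ioo (n : ℝ) (n + 1), deriv u c = u (n + 1) - u n := by
    obtain ⟨c, hc, h⟩ := exists_deriv_eq_slope u (lt_add_one (n : ℝ)) hu.continuous.continuousOn
      hu.differentiableOn
    exact ⟨c, hc, by simpa using h⟩
  choose ξ hξ hd using h
  refine ⟨ξ, fun n => n.cast_nonneg.trans (hξ n).1.le,
    tendsto_atTop_mono (fun n => (hξ n).1.le) tendsto_natCast_atTop_atTop, ?_⟩
  have hn : Tendsto (fun n : ℕ => (n : ℝ)) atTop atTop := tendsto_natCast_atTop_atTop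
  have := (hlim.comp (tendsto_atTop_add_const_right _ (1 : ℝ) hn)).sub (hlim.comp hn)
  simpa [hd, Function.comp_def] using this

/-- Energy identity for solutions of `u'' + f(u) = 0` on the half-line decaying to `0`. -/
theorem deriv_sq_eq_of_tendsto_zero {f u : ℝ → ℝ} (hf : Continuous f) (hu : ContDiff ℝ 2 u)
    (heq : ∀ x : ℝ, 0 ≤ x → deriv (deriv u) x + f (u x) = 0) (hlim : Tendsto u atTop (𝓝 0))
    {x : ℝ} (hx : 0 ≤ x) : deriv u x ^ 2 = -2 * F f (u x) := by
  have hd : Differentiable ℝ u := hu.differentiable (by norm_num)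
  set E : ℝ → ℝ := fun y => deriv u y ^ 2 + 2 * F f (u y) with hE
  have hE' (y : ℝ) : HasDerivAt E
      (2 * deriv u y * (deriv (deriv u) y + f (u y))) y := by
    have h1 := (hasDerivAt_deriv_of_contDiff_two hu y).pow 2
    have h2 := ((hasDerivAt_F hf (u y)).comp y (hd y).hasDerivAt).const_mul 2
    refine (h1.add h2).congr_deriv ?_
    push_cast
    ring
  have hconst : ∀ y, 0 ≤ y → E y = E 0 := fun y hy =>
    constant_of_has_deriv_right_zero (fun z _ => (hE' z).continuousAt.continuousWithinAt)
      (fun z hz => by simpa [heq z hz.1] using (hE' z).hasDerivWithinAt) y ⟨hy, le_rfl⟩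
  obtain ⟨ξ, hξ0, hξ, hdξ⟩ := exists_tendsto_atTop_deriv_tendsto_zero hd hlim
  have hF0 : F f 0 = 0 := intervalIntegral.integral_same
  have hFξ : Tendsto (fun n => F f (u (ξ n))) atTop (𝓝 0) := by
    have := ((hasDerivAt_F hf 0).continuousAt.tendsto.comp hlim).comp hξ
    rwa [hF0] at this
  have hEξ : Tendsto (fun n => E (ξ n)) atTop (𝓝 0) := by
    simpa [hE] using (hdξ.pow 2).add (hFξ.const_mul 2)
  have hE0 : E 0 = 0 := by
    refine tendsto_nhds_unique ?_ hEξ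
    simp only [hconst _ (hξ0 _)]
    exact tendsto_const_nhds
  have := hconst x hx
  simp only [hE0] at this
  linarith [show deriv u x ^ 2 + 2 * F f (u x) = 0 from this]

/-- Uniqueness for the initial value problem of `u'' + f(u) = 0`, for solutions with values in
`[c, d]`. -/
theorem eq_of_second_order_ode {f u w : ℝ → ℝ} {c d : ℝ} (hf : ContDiff ℝ 1 f)
    (hu : ContDiff ℝ 2 u) (hw : ContDiff ℝ 2 w)
    (hueq : ∀ x : ℝ, 0 ≤ x → deriv (deriv u) x + f (u x) = 0)
    (hweq : ∀ x : ℝ, 0 ≤ x → deriv (deriv w) x + f (w x) = 0)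
    (hus : ∀ x : ℝ, 0 ≤ x → u x ∈ Icc c d) (hws : ∀ x : ℝ, 0 ≤ x → w x ∈ Icc c d)
    (h0 : u 0 = w 0) (h0' : deriv u 0 = deriv w 0) {x : ℝ} (hx : 0 ≤ x) : u x = w x := by
  obtain ⟨K, hK⟩ := hf.contDiffOn.exists_lipschitzOnWith (by decide) (convex_Icc c d) isCompact_Icc
  have hlip : LipschitzOnWith (max 1 K) (fun p : ℝ × ℝ => (p.2, -f p.1)) (Icc c d ×ˢ univ) := by
    refine LipschitzOnWith.of_dist_le_mul fun p hp q hq => ?_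
    have h1 := hK.dist_le_mul p.1 hp.1 q.1 hq.1
    rw [Prod.dist_eq, dist_neg_neg]
    refine max_le ?_ (h1.trans ?_)
    · calc dist p.2 q.2 ≤ dist p q := le_max_right _ _
        _ = 1 * dist p q := (one_mul _).symm
        _ ≤ _ := by gcongr; exact_mod_cast le_max_left 1 K
    · gcongr
      · exact le_max_right 1 K
      · exact le_max_left _ _
  have hpair {y : ℝ → ℝ} (hy : ContDiff ℝ 2 y)
      (hyeq : ∀ x : ℝ, 0 ≤ x → deriv (deriv y) x + f (y x) = 0) (t : ℝ) (ht : 0 ≤ t) :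
      HasDerivAt (fun t => (y t, deriv y t)) (deriv y t, -f (y t)) t := by
    have h2 := hasDerivAt_deriv_of_contDiff_two hy t
    rw [eq_neg_of_add_eq_zero_left (hyeq t ht)] at h2
    exact (hy.differentiable (by norm_num) t).hasDerivAt.prodMk h2
  have key := ODE_solution_unique_of_mem_Icc_right (a := 0) (b := x)
    (v := fun (_ : ℝ) (p : ℝ × ℝ) => (p.2, -f p.1)) (s := fun _ => Icc c d ×ˢ univ)
    (f := fun t => (u t, deriv u t)) (g := fun t => (w t, deriv w t))
    (fun _ _ => hlip)
    (fun t ht => (hpair hu hueq t ht.1).continuousAt.continuousWithinAt)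
    (fun t ht => (hpair hu hueq t ht.1).hasDerivWithinAt) (fun t ht => ⟨hus t ht.1, trivial⟩)
    (fun t ht => (hpair hw hweq t ht.1).continuousAt.continuousWithinAt)
    (fun t ht => (hpair hw hweq t ht.1).hasDerivWithinAt) (fun t ht => ⟨hws t ht.1, trivial⟩)
    (by simp [h0, h0'])
  exact congrArg Prod.fst (key ⟨hx, le_rfl⟩)

theorem F_pos_of_lt {f : ℝ → ℝ} {a β s : ℝ} (hf : Continuous f)
    (hpos : ∀ s, a < s → s < 1 → 0 < f s) (haβ : a < β) (hFβ : F f β = 0) (hβs : β < s)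
    (hs1 : s < 1) : 0 < F f s := by
  have h : F f β + ∫ r in β..s, f r = F f s :=
    intervalIntegral.integral_add_adjacent_intervals (hf.intervalIntegrable _ _)
      (hf.intervalIntegrable _ _)
  rw [← h, hFβ, zero_add]
  exact intervalIntegral.intervalIntegral_pos_of_pos_on (hf.intervalIntegrable _ _)
    (fun x hx => hpos x (haβ.trans hx.1) (hx.2.trans hs1)) hβs

/-- Phase-plane fact: any stationary solution on a half-line staying in `(0,1)`
and tending to `0` at infinity is a translate of the pulse solution `V`. -/
theorem homoclinic_is_unique_decaying_orbit (f : ℝ → ℝ) (a β : ℝ) (hf : Bistable f a)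
    (hβ : a < β ∧ β < 1 ∧ F f β = 0)
    (V : ℝ → ℝ) (hV : ContDiff ℝ 2 V)
    (hVeq : ∀ x : ℝ, deriv (deriv V) x + f (V x) = 0)
    (hV0 : V 0 = β) (hV'0 : deriv V 0 = 0)
    (hVsymm : ∀ x : ℝ, V (-x) = V x)
    (hVbd : ∀ x : ℝ, 0 < V x ∧ V x ≤ β)
    (hVanti : StrictAntiOn V (Ici 0))
    (hVlim : Tendsto V atTop (𝓝 0))
    (v : ℝ → ℝ) (hv : ContDiff ℝ 2 v)
    (heq : ∀ x : ℝ, 0 ≤ x → deriv (deriv v) x + f (v x) = 0)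
    (hbd : ∀ x : ℝ, 0 ≤ x → 0 < v x ∧ v x < 1)
    (hlim : Tendsto v atTop (𝓝 0)) :
    ∃ b : ℝ, ∀ x : ℝ, 0 ≤ x → v x = V (x + b) := by
  obtain ⟨hfC, -, -, -, -, -, -, hpos, -, -, -, -⟩ := hf
  obtain ⟨haβ, hβ1, hFβ⟩ := hβ
  have hfc : Continuous f := hfC.continuous
  have hv0 := hbd 0 le_rfl
  have hle : v 0 ≤ β := by
    by_contra! h
    have h1 := F_pos_of_lt hfc hpos haβ hFβ h hv0.2
    have h2 := deriv_sq_eq_of_tendsto_zero hfc hv heq hlim le_rfl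
    nlinarith [sq_nonneg (deriv v 0)]
  obtain ⟨B, hB, hB0⟩ : ∃ B, V B < v 0 ∧ 0 ≤ B :=
    ((hVlim.eventually_lt_const hv0.1).and (eventually_ge_atTop 0)).exists
  obtain ⟨b, hb, hVb⟩ : v 0 ∈ V '' Icc 0 B :=
    intermediate_value_Icc' hB0 hV.continuous.continuousOn ⟨hB.le, hV0 ▸ hle⟩
  have hsq : deriv v 0 ^ 2 = deriv V b ^ 2 := by
    rw [deriv_sq_eq_of_tendsto_zero hfc hv heq hlim le_rfl,
      deriv_sq_eq_of_tendsto_zero hfc hV (fun x _ => hVeq x) hVlim hb.1, hVb]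
  have hodd : deriv V (-b) = -deriv V b := by
    have h := deriv_comp_neg V b
    rw [funext hVsymm] at h
    linarith
  obtain ⟨c, hc, hc'⟩ : ∃ c, v 0 = V c ∧ deriv v 0 = deriv V c := by
    rcases sq_eq_sq_iff_eq_or_eq_neg.1 hsq with h | h
    · exact ⟨b, hVb.symm, h⟩
    · exact ⟨-b, by rw [hVsymm, hVb], by rw [h, hodd]⟩
  have hd : deriv (fun x => V (x + c)) = fun x => deriv V (x + c) :=
    funext fun x => deriv_comp_add_const V c x
  refine ⟨c, fun x hx => eq_of_second_order_ode (w := fun x => V (x + c)) (c := 0) (d := 1) hfC hv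
    (hV.comp (contDiff_id.add contDiff_const)) heq (fun x _ => ?_)
    (fun x hx => ⟨(hbd x hx).1.le, (hbd x hx).2.le⟩)
    (fun x _ => ⟨(hVbd _).1.le, (hVbd _).2.trans hβ1.le⟩) (by simpa using hc) (by simpa [hd] using hc')
    hx⟩
  rw [hd, deriv_comp_add_const]
  exact hVeq _
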